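/- arXiv:1901.02375 — 2 statements merged into one kernel-verified Lean document; each statement's English description precedes it below -/
import Mathlib

section
/- The region of optimality of the saturated path design on m alternatives is not empty: there exists β ∈ ℝ^{m−1} such that λ_{ij}(β) · Σ_{k=i}^{j−1} λ_{k,k+1}(β)^{-1} ≤ 1 for all 1 ≤ i < j ≤ m. -/
open Finset

noncomputable section

/-- Extension of the parameter vector `β ∈ ℝ^{m-1}` to all `m` alternatives,
with the convention `β_m = 0` (0-based: last alternative has value 0). -/
def betaExt (m : ℕ) (β : Fin (m - 1) → ℝ) (i : ℕ) : ℝ :=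
  if h : i < m - 1 then β ⟨i, h⟩ else 0

/-- The intensity `λ_{ij}(β) = exp(β_i - β_j)/(1+exp(β_i - β_j))²` (0-based indices). -/
def lam (m : ℕ) (β : Fin (m - 1) → ℝ) (i j : ℕ) : ℝ :=
  Real.exp (betaExt m β i - betaExt m β j) /
    (1 + Real.exp (betaExt m β i - betaExt m β j)) ^ 2

/-- With equal spacing `log 4`, the intensity of a pair at distance `n` is `4ⁿ / (1 + 4ⁿ)²`. -/
theorem lam_log_four (m : ℕ) {i n : ℕ} (h : i + n < m) :
    lam m (fun k => ((m : ℝ) - 1 - (k : ℕ)) * Real.log 4) i (i + n) =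
      4 ^ n / (1 + 4 ^ n) ^ 2 := by
  have key : ∀ k < m, betaExt m (fun k => ((m : ℝ) - 1 - (k : ℕ)) * Real.log 4) k =
      ((m : ℝ) - 1 - k) * Real.log 4 := by
    intro k hk
    unfold betaExt
    split_ifs with hlt
    · rfl
    · obtain rfl : m = k + 1 := by omega
      push_cast
      ring
  have hexp : Real.exp (n * Real.log 4) = 4 ^ n := by
    rw [Real.exp_nat_mul, Real.exp_log (by norm_num)]
  have hdiff : ((m : ℝ) - 1 - i) * Real.log 4 - ((m : ℝ) - 1 - (i + n : ℕ)) * Real.log 4 =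
      n * Real.log 4 := by
    push_cast
    ring
  rw [lam, key i (by omega), key (i + n) h, hdiff, hexp]

theorem mul_le_two_add_four_pow (n : ℕ) : ((n + 2 : ℕ) : ℝ) * (25 / 4) ≤ 2 + 4 ^ (n + 2) := by
  induction n with
  | zero => norm_num
  | succ n ih =>
    have h : (1 : ℝ) ≤ 4 ^ n := one_le_pow₀ (by norm_num)
    push_cast at ih ⊢
    rw [pow_succ, pow_add] at *
    linarith

theorem four_pow_mul_le (n : ℕ) : (4 : ℝ) ^ n * (n * (25 / 4)) ≤ (1 + 4 ^ n) ^ 2 := by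
  match n with
  | 0 => norm_num
  | 1 => norm_num
  | n + 2 =>
    have h := mul_le_mul_of_nonneg_left (mul_le_two_add_four_pow n)
      (by positivity : (0 : ℝ) ≤ 4 ^ (n + 2))
    linarith [h, add_sq (1 : ℝ) (4 ^ (n + 2)), mul_add ((4 : ℝ) ^ (n + 2)) 2 (4 ^ (n + 2)),
      sq ((4 : ℝ) ^ (n + 2))]

/-- The region of optimality of the saturated path design is nonempty: there is a
parameter `β` with `λ_{ij}(β) · Σ_{k=i}^{j-1} λ_{k,k+1}(β)⁻¹ ≤ 1` for all pairs `i < j`. -/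
theorem pathDesign_optimality_region_nonempty (m : ℕ) (hm : 2 ≤ m) :
    ∃ β : Fin (m - 1) → ℝ,
      ∀ i j : Fin m, i < j →
        lam m β i j * ∑ k ∈ Finset.Ico (i : ℕ) (j : ℕ), (lam m β k (k + 1))⁻¹ ≤ 1 := by
  refine ⟨fun k => ((m : ℝ) - 1 - (k : ℕ)) * Real.log 4, ?_⟩
  rintro ⟨i, hi⟩ ⟨j, hj⟩ hij
  obtain ⟨n, rfl⟩ := Nat.exists_eq_add_of_lt (Fin.mk_lt_mk.mp hij)
  rw [add_assoc] at hj
  have hsum : ∀ k ∈ Finset.Ico i (i + (n + 1)),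
      (lam m (fun k => ((m : ℝ) - 1 - (k : ℕ)) * Real.log 4) k (k + 1))⁻¹ = 25 / 4 := by
    intro k hk
    rw [lam_log_four m (by have := Finset.mem_Ico.mp hk; omega)]
    norm_num
  simp only [add_assoc i n 1]
  rw [Finset.sum_congr rfl hsum, lam_log_four m hj, Finset.sum_const, Nat.card_Ico,
    Nat.add_sub_cancel_left, nsmul_eq_mul, div_mul_eq_mul_div]
  exact div_le_one_of_le₀ (four_pow_mul_le (n + 1)) (by positivity)

end
end

section
/- Let n ≥ 2, let F be an invertible n×n real matrix whose first column is the first standard unit vector e₁, and let D be an invertible diagonal n×n real matrix. Let F̄ and D̄ denote the lower-right (n−1)×(n−1) blocks of F and D respectively. Then F̄ is invertible, and for every vector v̄ ∈ ℝ^{n−1}, writing v = (0, v̄) ∈ ℝⁿ, one has v^T F^{-1} D^{-1} F^{-T} v = v̄^T F̄^{-1} D̄^{-1} F̄^{-T} v̄. -/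
open Matrix

noncomputable section

/-- The embedding of indices selecting the lower-right `(N-1)×(N-1)` block. -/
def lowerEmb (N : ℕ) : Fin (N - 1) → Fin N :=
  fun k => ⟨(k : ℕ) + 1, by have := k.isLt; omega⟩

/-- The vector `v = (0, v̄) ∈ ℝᴺ` obtained from `v̄ ∈ ℝ^{N-1}`. -/
def extVec (N : ℕ) (vb : Fin (N - 1) → ℝ) : Fin N → ℝ :=
  fun i => if h : 0 < (i : ℕ) then vb ⟨(i : ℕ) - 1, by have := i.isLt; omega⟩ else 0

theorem extVec_succ (m : ℕ) (w : Fin m → ℝ) :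
    extVec (m + 1) w = (Fin.cons 0 w : Fin (m + 1) → ℝ) := by
  funext i
  refine Fin.cases ?_ (fun j => ?_) i <;> simp [extVec]

theorem dotProduct_mul_mul_transpose_mulVec {R n : Type*} [CommRing R] [Fintype n]
    (A B : Matrix n n R) (x : n → R) :
    x ⬝ᵥ (A * B * Aᵀ) *ᵥ x = (Aᵀ *ᵥ x) ⬝ᵥ B *ᵥ (Aᵀ *ᵥ x) := by
  rw [← mulVec_mulVec, ← mulVec_mulVec, dotProduct_mulVec, mulVec_transpose]

theorem inv_diagonal_of_forall_ne_zero {K n : Type*} [Field K] [Fintype n] [DecidableEq n]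
    (d : n → K) (hd : ∀ i, d i ≠ 0) :
    (diagonal d)⁻¹ = diagonal fun i => (d i)⁻¹ := by
  apply inv_eq_right_inv
  simp [diagonal_mul_diagonal, hd]

theorem det_eq_det_submatrix_succ {R : Type*} [CommRing R] {m : ℕ}
    (F : Matrix (Fin (m + 1)) (Fin (m + 1)) R)
    (hcol : ∀ i, F i 0 = if i = 0 then 1 else 0) :
    F.det = (F.submatrix Fin.succ Fin.succ).det := by
  simp [det_succ_column_zero, hcol]

theorem transpose_mulVec_cons_zero {R : Type*} [CommRing R] {m : ℕ}
    (F : Matrix (Fin (m + 1)) (Fin (m + 1)) R)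
    (hcol : ∀ i, F i 0 = if i = 0 then 1 else 0) (w : Fin m → R) :
    Fᵀ *ᵥ (Fin.cons 0 w : Fin (m + 1) → R) =
      (Fin.cons 0 ((F.submatrix Fin.succ Fin.succ)ᵀ *ᵥ w) : Fin (m + 1) → R) := by
  funext i
  refine Fin.cases ?_ (fun j => ?_) i <;>
    simp [mulVec, dotProduct, Fin.sum_univ_succ, hcol]

/-- Let `F` be an invertible `N×N` real matrix (`N ≥ 2`) whose first column is the first
standard unit vector, and let `D = diagonal d` be an invertible diagonal matrix. Then the
lower-right `(N-1)×(N-1)` block `F̄` of `F` is invertible, and for every `v̄ ∈ ℝ^{N-1}`,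
with `v = (0, v̄)`, one has `vᵀ F⁻¹ D⁻¹ F⁻ᵀ v = v̄ᵀ F̄⁻¹ D̄⁻¹ F̄⁻ᵀ v̄`, where `D̄` is the
lower-right block of `D`. -/
theorem block_reduction_quadratic_form (N : ℕ) (hN : 2 ≤ N)
    (F : Matrix (Fin N) (Fin N) ℝ) (hF : IsUnit F)
    (hcol : ∀ i : Fin N, F i ⟨0, by omega⟩ = if i = ⟨0, by omega⟩ then 1 else 0)
    (d : Fin N → ℝ) (hd : ∀ i, d i ≠ 0) :
    IsUnit (F.submatrix (lowerEmb N) (lowerEmb N)) ∧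
      ∀ vb : Fin (N - 1) → ℝ,
        extVec N vb ⬝ᵥ
            (F⁻¹ * (Matrix.diagonal d)⁻¹ * (F⁻¹)ᵀ).mulVec (extVec N vb) =
          vb ⬝ᵥ
            ((F.submatrix (lowerEmb N) (lowerEmb N))⁻¹ *
              ((Matrix.diagonal d).submatrix (lowerEmb N) (lowerEmb N))⁻¹ *
              ((F.submatrix (lowerEmb N) (lowerEmb N))⁻¹)ᵀ).mulVec vb := by
  obtain ⟨m, rfl⟩ : ∃ m, N = m + 1 := ⟨N - 1, by omega⟩
  have hcol' : ∀ i : Fin (m + 1), F i 0 = if i = 0 then 1 else 0 := hcol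
  change IsUnit (F.submatrix Fin.succ Fin.succ) ∧ ∀ w : Fin m → ℝ,
    extVec (m + 1) w ⬝ᵥ (F⁻¹ * (diagonal d)⁻¹ * (F⁻¹)ᵀ) *ᵥ extVec (m + 1) w =
      w ⬝ᵥ ((F.submatrix Fin.succ Fin.succ)⁻¹ *
        ((diagonal d).submatrix Fin.succ Fin.succ)⁻¹ *
        ((F.submatrix Fin.succ Fin.succ)⁻¹)ᵀ) *ᵥ w
  have hdet : IsUnit F.det := (isUnit_iff_isUnit_det F).1 hF
  have hdet' : IsUnit (F.submatrix Fin.succ Fin.succ).det := by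
    rwa [← det_eq_det_submatrix_succ F hcol']
  refine ⟨(isUnit_iff_isUnit_det _).2 hdet', fun w => ?_⟩
  set G := F.submatrix Fin.succ Fin.succ with hG
  have hsolve : (F⁻¹)ᵀ *ᵥ extVec (m + 1) w =
      (Fin.cons 0 ((G⁻¹)ᵀ *ᵥ w) : Fin (m + 1) → ℝ) := by
    have h := transpose_mulVec_cons_zero F hcol' ((G⁻¹)ᵀ *ᵥ w)
    rw [← hG, mulVec_mulVec, ← transpose_mul, nonsing_inv_mul _ hdet', transpose_one,
      one_mulVec, ← extVec_succ m w] at h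
    rw [← h, mulVec_mulVec, ← transpose_mul, mul_nonsing_inv _ hdet, transpose_one,
      one_mulVec]
  rw [dotProduct_mul_mul_transpose_mulVec, dotProduct_mul_mul_transpose_mulVec, hsolve,
    submatrix_diagonal _ _ (Fin.succ_injective m), inv_diagonal_of_forall_ne_zero d hd,
    inv_diagonal_of_forall_ne_zero (d ∘ Fin.succ) fun i => hd i.succ]
  simp [dotProduct, mulVec_diagonal, Fin.sum_univ_succ]

end
end
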